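/- arXiv:2104.14731 — 3 statements merged into one kernel-verified Lean document; each statement's English description precedes it below -/
import Mathlib

section
/- Let 1 < E ≤ R^{1/2} and let 𝒯 be a collection of spherical caps of radius E^{−1} in 𝕊² such that every point of 𝕊² lies in at most C₀ caps of 𝒯. Then there is a constant C', depending only on C₀ and the constants in the hypotheses on Φ, such that each cube q ∈ 𝐪 belongs to at most C' of the sets { 𝐪(τ) : τ ∈ 𝒯 }. -/
open MeasureTheory Metric Set
open scoped ENNReal NNReal Real InnerProductSpace

noncomputable section

abbrev E2 := EuclideanSpace ℝ (Fin 2)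
abbrev E3 := EuclideanSpace ℝ (Fin 3)

def proj2 (ξ : E3) : E2 := (EuclideanSpace.equiv (Fin 2) ℝ).symm fun i => ξ i.castSucc

def mk3 (v : E2) (s : ℝ) : E3 := (EuclideanSpace.equiv (Fin 3) ℝ).symm ![v 0, v 1, s]

/-- Regularity and curvature hypotheses on the phase `Φ(ξ̄; t)`. -/
def PhiHyp (c₀ C₀ : ℝ) (Φ : E2 → ℝ → ℝ) : Prop :=
  ContDiff ℝ (⊤ : ℕ∞) (Function.uncurry Φ) ∧
  ∀ ξ : E2, ‖ξ‖ ≤ 1/2 → ∀ s ∈ Set.Icc (1:ℝ) 4,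
    (c₀ ≤ |deriv (Φ ξ) s| ∧ |deriv (Φ ξ) s| ≤ C₀) ∧
    ‖deriv (fun u => fderiv ℝ (fun y => Φ y u) ξ) s‖ ≤ C₀ ∧
    ∀ v : E2,
      fderiv ℝ (fun y => fderiv ℝ (fun z => Φ z s) y v) ξ v ≤ -c₀ * ‖v‖ ^ 2 ∧
      -C₀ * ‖v‖ ^ 2 ≤ fderiv ℝ (fun y => fderiv ℝ (fun z => Φ z s) y v) ξ v

/-- The Gauss map of the surface `Γ_j`, `G_j(ξ̄) = (∇_ξ̄Φ(ξ̄;t_j), 1)/|(∇_ξ̄Φ(ξ̄;t_j), 1)|`. -/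
def gaussMapAt (Φ : E2 → ℝ → ℝ) (s : ℝ) (ξ : E2) : E3 :=
  ‖mk3 (gradient (fun y => Φ y s) ξ) 1‖⁻¹ • mk3 (gradient (fun y => Φ y s) ξ) 1

/-- The spherical cap of radius `r` centered at `z ∈ 𝕊²`. -/
def capSet (z : E3) (r : ℝ) : Set E3 := {v : E3 | ‖v‖ = 1 ∧ ‖v - z‖ ≤ r}

/-- The portion `Γ_j(τ)` of the surface `Γ_j = {(ξ̄, Φ(ξ̄; t_j)) : |ξ̄| ≤ 1/2}` whose
normal directions lie in the dilated cap `2τ` (`τ` of radius `r` centered at `z`). -/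
def gammaTau (Φ : E2 → ℝ → ℝ) (s : ℝ) (z : E3) (r : ℝ) : Set E3 :=
  (fun v => mk3 v (Φ v s)) ''
    {v : E2 | v ∈ Metric.closedBall 0 (1/2) ∧ gaussMapAt Φ s v ∈ capSet z (2 * r)}

/-- The cube of side length `s * Cq * R^{-1/2}` centered at the lattice point
`R^{-1/2} m`. -/
def qcube (R : ℕ) (Cq : ℝ) (m : Fin 3 → ℤ) (s : ℝ) : Set E3 :=
  {ξ : E3 | ∀ i : Fin 3,
    |ξ i - ((R : ℝ)) ^ (-(1/2) : ℝ) * m i| ≤ s * Cq * ((R : ℝ)) ^ (-(1/2) : ℝ) / 2}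

lemma norm_mk3_sub_mk3 (a b : E2) (s : ℝ) : ‖mk3 a s - mk3 b s‖ = ‖a - b‖ := by
  simp [EuclideanSpace.norm_eq, mk3, Fin.sum_univ_three, Fin.sum_univ_two]

lemma norm_mk3_sq (a : E2) (s : ℝ) : ‖mk3 a s‖ ^ 2 = ‖a‖ ^ 2 + s ^ 2 := by
  simp [EuclideanSpace.norm_sq_eq, mk3, Fin.sum_univ_three, Fin.sum_univ_two]

lemma norm_le_norm_mk3 (a : E2) (s : ℝ) : ‖a‖ ≤ ‖mk3 a s‖ := by
  nlinarith [norm_mk3_sq a s, norm_nonneg a, norm_nonneg (mk3 a s), sq_nonneg s]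

lemma one_le_norm_mk3_one (a : E2) : 1 ≤ ‖mk3 a 1‖ := by
  nlinarith [norm_mk3_sq a 1, norm_nonneg a, norm_nonneg (mk3 a 1)]

lemma norm_inv_smul_sub_inv_smul_le {V : Type*} [NormedAddCommGroup V] [NormedSpace ℝ V]
    {x y : V} (hx : x ≠ 0) (hy : y ≠ 0) :
    ‖‖x‖⁻¹ • x - ‖y‖⁻¹ • y‖ ≤ 2 * ‖x - y‖ / ‖x‖ := by
  have hx' : 0 < ‖x‖ := norm_pos_iff.2 hx
  have hy' : 0 < ‖y‖ := norm_pos_iff.2 hy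
  have key : ‖x‖⁻¹ • x - ‖y‖⁻¹ • y
      = ‖x‖⁻¹ • ((x - y) + (‖y‖⁻¹ * (‖y‖ - ‖x‖)) • y) := by
    have h : ‖x‖⁻¹ * (‖y‖⁻¹ * (‖y‖ - ‖x‖)) = ‖x‖⁻¹ - ‖y‖⁻¹ := by field_simp
    rw [smul_add, smul_smul, h, smul_sub, sub_smul]
    abel
  have h2 : ‖(‖y‖⁻¹ * (‖y‖ - ‖x‖)) • y‖ ≤ ‖x - y‖ := by
    rw [norm_smul, norm_mul, norm_inv, norm_norm, Real.norm_eq_abs]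
    have : ‖y‖⁻¹ * |‖y‖ - ‖x‖| * ‖y‖ = |‖y‖ - ‖x‖| := by field_simp
    rw [this, norm_sub_rev x y]
    exact abs_norm_sub_norm_le y x
  rw [key, norm_smul, norm_inv, norm_norm, inv_mul_eq_div]
  gcongr
  linarith [norm_add_le (x - y) ((‖y‖⁻¹ * (‖y‖ - ‖x‖)) • y)]

/-- A symmetric bilinear form is bounded in norm by the bound on its quadratic form. -/
lemma norm_le_of_abs_quadratic_le {V : Type*} [NormedAddCommGroup V] [InnerProductSpace ℝ V]
    (B : V →L[ℝ] V →L[ℝ] ℝ) (hB : ∀ u v, B u v = B v u) {C : ℝ} (hC : 0 ≤ C)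
    (h : ∀ v, |B v v| ≤ C * ‖v‖ ^ 2) : ‖B‖ ≤ C := by
  refine B.opNorm_le_of_unit_norm hC fun u hu => ?_
  refine (B u).opNorm_le_of_unit_norm hC fun v hv => ?_
  have hpar := parallelogram_law_with_norm ℝ u v
  have h4 : 4 * B u v = B (u + v) (u + v) - B (u - v) (u - v) := by
    simp only [map_add, map_sub, add_apply, sub_apply,
      hB v u]
    ring
  have h1 := abs_le.1 (h (u + v))
  have h2 := abs_le.1 (h (u - v))
  rw [hu, hv] at hpar
  rw [Real.norm_eq_abs, abs_le]
  constructor <;> nlinarith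

/-- Boundedly many points of bounded multiplicity at scale `E⁻¹` fit in a ball of radius
comparable to `E⁻¹`. -/
lemma exists_ncard_le_of_bounded_overlap (ρ : ℝ) (C₁ : ℕ) :
    ∃ N : ℕ, ∀ E : ℝ, 0 < E → ∀ (ι : Type) (z : ι → E3), (∀ i, ‖z i‖ = 1) →
      (∀ v : E3, ‖v‖ = 1 →
          {i : ι | v ∈ capSet (z i) E⁻¹}.Finite ∧
          {i : ι | v ∈ capSet (z i) E⁻¹}.ncard ≤ C₁) →
      ∀ S : Set ι, (∀ i ∈ S, ∀ j ∈ S, ‖z i - z j‖ ≤ ρ * E⁻¹) →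
        S.Finite ∧ S.ncard ≤ N := by
  obtain ⟨T, -, hT, hcov⟩ :=
    (isCompact_closedBall (0 : E3) ρ).finite_cover_balls (e := 1 / 2) (by norm_num)
  refine ⟨hT.toFinset.card * C₁, fun E hE ι z hz hov S hS => ?_⟩
  rcases S.eq_empty_or_nonempty with rfl | ⟨k, hk⟩
  · simp
  let P : E3 → Set ι := fun x => {i | i ∈ S ∧ E • (z i - z k) ∈ ball x (1 / 2)}
  have hP : ∀ x, (P x).Finite ∧ (P x).ncard ≤ C₁ := by
    intro x
    rcases (P x).eq_empty_or_nonempty with h | ⟨l, -, hl⟩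
    · simp [h]
    have hsub : P x ⊆ {i : ι | z l ∈ capSet (z i) E⁻¹} := by
      rintro i ⟨-, hi⟩
      refine ⟨hz l, ?_⟩
      have h1 : dist (E • (z l - z k)) (E • (z i - z k)) ≤ 1 := by
        have := dist_triangle_right (E • (z l - z k)) (E • (z i - z k)) x
        rw [mem_ball] at hl hi
        linarith
      rw [dist_eq_norm, ← smul_sub, sub_sub_sub_cancel_right, norm_smul, Real.norm_eq_abs,
        abs_of_pos hE] at h1
      rw [← one_div, le_div_iff₀ hE]
      linarith
    have ho := hov (z l) (hz l)
    exact ⟨ho.1.subset hsub, (ncard_le_ncard hsub ho.1).trans ho.2⟩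
  have hSU : S ⊆ ⋃ x ∈ hT.toFinset, P x := by
    intro i hi
    have hmem : E • (z i - z k) ∈ closedBall (0 : E3) ρ := by
      rw [mem_closedBall_zero_iff, norm_smul, Real.norm_eq_abs, abs_of_pos hE]
      have := hS i hi k hk
      rw [← div_eq_mul_inv, le_div_iff₀ hE] at this
      linarith
    obtain ⟨x, hx, hxi⟩ := mem_iUnion₂.1 (hcov hmem)
    exact mem_iUnion₂.2 ⟨x, by simpa using hx, hi, hxi⟩
  have hfin : (⋃ x ∈ hT.toFinset, P x).Finite :=
    hT.toFinset.finite_toSet.biUnion fun x _ => (hP x).1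
  refine ⟨hfin.subset hSU, (ncard_le_ncard hSU hfin).trans ?_⟩
  refine (Finset.set_ncard_biUnion_le _ _).trans ?_
  simpa using Finset.sum_le_card_nsmul hT.toFinset (fun x => (P x).ncard) C₁ fun x _ => (hP x).2

lemma PhiHyp.contDiff_slice {c₀ C₀ : ℝ} {Φ : E2 → ℝ → ℝ} (h : PhiHyp c₀ C₀ Φ) (s : ℝ) :
    ContDiff ℝ (⊤ : ℕ∞) (fun y => Φ y s) :=
  h.1.comp (contDiff_id.prodMk contDiff_const)

lemma PhiHyp.contDiff_time {c₀ C₀ : ℝ} {Φ : E2 → ℝ → ℝ} (h : PhiHyp c₀ C₀ Φ) (ξ : E2) :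
    ContDiff ℝ (⊤ : ℕ∞) (Φ ξ) :=
  h.1.comp (contDiff_const.prodMk contDiff_id)

lemma PhiHyp.differentiable_fderiv_time {c₀ C₀ : ℝ} {Φ : E2 → ℝ → ℝ} (h : PhiHyp c₀ C₀ Φ)
    (ξ : E2) : Differentiable ℝ (fun u => fderiv ℝ (fun y => Φ y u) ξ) := by
  have h1 : ContDiff ℝ (⊤ : ℕ∞) (Function.uncurry fun u y => Φ y u) :=
    h.1.comp (contDiff_snd.prodMk contDiff_fst)
  have h2 : ContDiff ℝ 1 (fun u => fderiv ℝ (fun y => Φ y u) ξ) :=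
    ContDiff.fderiv h1 contDiff_const (by norm_cast)
  exact h2.differentiable one_ne_zero

lemma PhiHyp.contDiff_fderiv_slice {c₀ C₀ : ℝ} {Φ : E2 → ℝ → ℝ} (h : PhiHyp c₀ C₀ Φ) (s : ℝ) :
    ContDiff ℝ 1 (fderiv ℝ fun y => Φ y s) :=
  (h.contDiff_slice s).fderiv_right (by norm_cast)

lemma PhiHyp.norm_hessian_le {c₀ C₀ : ℝ} (hc₀ : 0 < c₀) (hC₀ : c₀ < C₀) {Φ : E2 → ℝ → ℝ}
    (h : PhiHyp c₀ C₀ Φ) {ξ : E2} (hξ : ‖ξ‖ ≤ 1/2) {s : ℝ} (hs : s ∈ Icc (1:ℝ) 4) :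
    ‖fderiv ℝ (fderiv ℝ fun y => Φ y s) ξ‖ ≤ C₀ := by
  have hd : DifferentiableAt ℝ (fderiv ℝ fun y => Φ y s) ξ :=
    (h.contDiff_fderiv_slice s).differentiable one_ne_zero ξ
  have hsymm : IsSymmSndFDerivAt ℝ (fun y => Φ y s) ξ :=
    (h.contDiff_slice s).contDiffAt.isSymmSndFDerivAt (by simp; norm_cast)
  refine norm_le_of_abs_quadratic_le _ (fun u v => hsymm u v) (by linarith) fun v => ?_
  have hv := (h.2 ξ hξ s hs).2.2 v
  have he : fderiv ℝ (fun y => fderiv ℝ (fun z => Φ z s) y v) ξ v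
      = fderiv ℝ (fderiv ℝ fun y => Φ y s) ξ v v := by
    rw [fderiv_clm_apply hd (differentiableAt_const v)]
    simp
  rw [he] at hv
  have := mul_nonneg hc₀.le (sq_nonneg ‖v‖)
  rw [abs_le]
  constructor <;> nlinarith

lemma PhiHyp.norm_fderiv_sub_le {c₀ C₀ : ℝ} (hc₀ : 0 < c₀) (hC₀ : c₀ < C₀) {Φ : E2 → ℝ → ℝ}
    (h : PhiHyp c₀ C₀ Φ) {ξ η : E2} (hξ : ‖ξ‖ ≤ 1/2) (hη : ‖η‖ ≤ 1/2) {s : ℝ}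
    (hs : s ∈ Icc (1:ℝ) 4) :
    ‖fderiv ℝ (fun y => Φ y s) ξ - fderiv ℝ (fun y => Φ y s) η‖ ≤ C₀ * ‖ξ - η‖ :=
  (convex_closedBall (0 : E2) (1/2)).norm_image_sub_le_of_norm_fderiv_le
    (fun x _ => (h.contDiff_fderiv_slice s).differentiable one_ne_zero x)
    (fun _ hx => h.norm_hessian_le hc₀ hC₀ (by simpa using hx) hs)
    (by simpa using hη) (by simpa using hξ)

lemma PhiHyp.norm_fderiv_sub_time_le {c₀ C₀ : ℝ} {Φ : E2 → ℝ → ℝ}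
    (h : PhiHyp c₀ C₀ Φ) {ξ : E2} (hξ : ‖ξ‖ ≤ 1/2) {s s' : ℝ}
    (hs : s ∈ Icc (1:ℝ) 4) (hs' : s' ∈ Icc (1:ℝ) 4) :
    ‖fderiv ℝ (fun y => Φ y s) ξ - fderiv ℝ (fun y => Φ y s') ξ‖ ≤ C₀ * |s - s'| :=
  (convex_Icc (1:ℝ) 4).norm_image_sub_le_of_norm_deriv_le
    (f := fun u => fderiv ℝ (fun y => Φ y u) ξ)
    (fun x _ => h.differentiable_fderiv_time ξ x)
    (fun x hx => (h.2 ξ hξ x hx).2.1) hs' hs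

lemma PhiHyp.mul_abs_sub_le {c₀ C₀ : ℝ} {Φ : E2 → ℝ → ℝ}
    (h : PhiHyp c₀ C₀ Φ) {ξ : E2} (hξ : ‖ξ‖ ≤ 1/2) {s s' : ℝ}
    (hs : s ∈ Icc (1:ℝ) 4) (hs' : s' ∈ Icc (1:ℝ) 4) :
    c₀ * |s - s'| ≤ |Φ ξ s - Φ ξ s'| := by
  wlog hlt : s' < s generalizing s s'
  · rcases (not_lt.1 hlt).eq_or_lt with rfl | hlt'
    · simp
    · rw [abs_sub_comm s, abs_sub_comm (Φ ξ s)]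
      exact this hs' hs hlt'
  have hd : Differentiable ℝ (Φ ξ) := (h.contDiff_time ξ).differentiable (by simp)
  obtain ⟨u, hu, hu'⟩ := exists_deriv_eq_slope (Φ ξ) hlt hd.continuous.continuousOn
    hd.differentiableOn
  rw [eq_div_iff (by linarith)] at hu'
  rw [← hu', abs_mul]
  gcongr
  exact (h.2 ξ hξ u ⟨by linarith [hu.1, hs'.1], by linarith [hu.2, hs.2]⟩).1.1

/-- Points on the surfaces `Γ_j`, `Γ_k` whose coordinates are `δ`-close have normals at distance
`O(δ)`; no bound on `∇Φ` is needed, since the Gauss map is normalized. -/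
lemma PhiHyp.norm_gaussMapAt_sub_le {c₀ C₀ : ℝ} (hc₀ : 0 < c₀) (hC₀ : c₀ < C₀) {Φ : E2 → ℝ → ℝ}
    (h : PhiHyp c₀ C₀ Φ) {ξ η : E2} (hξ : ‖ξ‖ ≤ 1/2) (hη : ‖η‖ ≤ 1/2) {s s' : ℝ}
    (hs : s ∈ Icc (1:ℝ) 4) (hs' : s' ∈ Icc (1:ℝ) 4) {δ : ℝ} (hξη : ‖ξ - η‖ ≤ 2 * δ)
    (hΦ : |Φ ξ s - Φ η s'| ≤ δ) :
    ‖gaussMapAt Φ s ξ - gaussMapAt Φ s' η‖ ≤ 2 * (2 * C₀ + C₀ / c₀ * (3 + 2 * C₀)) * δ := by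
  have hC : 0 < C₀ := hc₀.trans hC₀
  have hδ : 0 ≤ δ := by linarith [norm_nonneg (ξ - η)]
  set a := gradient (fun y => Φ y s) ξ with ha
  set b := gradient (fun y => Φ y s') η with hb
  have hX1 := one_le_norm_mk3_one a
  have hY1 := one_le_norm_mk3_one b
  have hXa := norm_le_norm_mk3 a 1
  set X := mk3 a 1
  set Y := mk3 b 1
  have hna : ‖fderiv ℝ (fun y => Φ y s) ξ‖ = ‖a‖ := by simp [ha, gradient]
  have hab : ‖a - b‖ = ‖fderiv ℝ (fun y => Φ y s) ξ - fderiv ℝ (fun y => Φ y s') η‖ := by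
    rw [ha, hb, gradient, gradient, ← map_sub, LinearIsometryEquiv.norm_map]
  have hgrad : ∀ x ∈ closedBall (0 : E2) (1/2), ‖fderiv ℝ (fun y => Φ y s) x‖ ≤ ‖a‖ + C₀ := by
    intro x hx
    have hx' : ‖x‖ ≤ 1/2 := by simpa using hx
    have h1 := h.norm_fderiv_sub_le hc₀ hC₀ hx' hξ hs
    have h2 : ‖x - ξ‖ ≤ 1 := by linarith [norm_sub_le x ξ]
    have h3 := norm_sub_norm_le (fderiv ℝ (fun y => Φ y s) x) (fderiv ℝ (fun y => Φ y s) ξ)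
    nlinarith
  have hlip : |Φ η s - Φ ξ s| ≤ (‖a‖ + C₀) * ‖η - ξ‖ :=
    (convex_closedBall (0 : E2) (1/2)).norm_image_sub_le_of_norm_fderiv_le
      (f := fun y => Φ y s)
      (fun x _ => (h.contDiff_slice s).differentiable (by simp) x) hgrad
      (by simpa using hξ) (by simpa using hη)
  have htime := h.mul_abs_sub_le hη hs hs'
  have hst : |s - s'| ≤ (3 + 2 * C₀) * δ * ‖X‖ / c₀ := by
    rw [le_div_iff₀ hc₀]
    have h1 := abs_sub_le (Φ η s) (Φ ξ s) (Φ η s')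
    rw [norm_sub_rev] at hlip
    have h2 : (‖a‖ + C₀) * ‖ξ - η‖ ≤ (‖X‖ + C₀ * ‖X‖) * (2 * δ) := by
      gcongr
      nlinarith
    have h3 : δ ≤ δ * ‖X‖ := le_mul_of_one_le_right hδ hX1
    nlinarith
  have h1 := h.norm_fderiv_sub_le hc₀ hC₀ hξ hη hs
  have h2 := h.norm_fderiv_sub_time_le hη hs hs'
  have hXY : ‖X - Y‖ ≤ (2 * C₀ + C₀ / c₀ * (3 + 2 * C₀)) * δ * ‖X‖ := by
    rw [norm_mk3_sub_mk3, hab]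
    refine (norm_sub_le_norm_sub_add_norm_sub _ (fderiv ℝ (fun y => Φ y s) η) _).trans ?_
    have h3 : C₀ * ‖ξ - η‖ ≤ C₀ * (2 * δ) := by gcongr
    have h4 : C₀ * |s - s'| ≤ C₀ * ((3 + 2 * C₀) * δ * ‖X‖ / c₀) := by gcongr
    have h5 : C₀ * (2 * δ) ≤ C₀ * (2 * δ) * ‖X‖ := le_mul_of_one_le_right (by positivity) hX1
    have h6 : (2 * C₀ + C₀ / c₀ * (3 + 2 * C₀)) * δ * ‖X‖
        = C₀ * (2 * δ) * ‖X‖ + C₀ * ((3 + 2 * C₀) * δ * ‖X‖ / c₀) := by ring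
    linarith
  have hX : 0 < ‖X‖ := by linarith
  have hY : 0 < ‖Y‖ := by linarith
  refine (norm_inv_smul_sub_inv_smul_le (norm_pos_iff.1 hX) (norm_pos_iff.1 hY)).trans ?_
  rw [div_le_iff₀ hX]
  linarith

lemma abs_sub_le_of_mem_qcube {R : ℕ} {Cq : ℝ} {m : Fin 3 → ℤ} {x y : E3}
    (hx : x ∈ qcube R Cq m 1) (hy : y ∈ qcube R Cq m 1) (i : Fin 3) :
    |x i - y i| ≤ Cq * (R : ℝ) ^ (-(1/2) : ℝ) := by
  have h1 := hx i
  have h2 := hy i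
  rw [abs_le] at *
  constructor <;> linarith

lemma norm_sub_le_two_mul_of_coord {a b : E2} {δ : ℝ}
    (h : ∀ i, |a i - b i| ≤ δ) : ‖a - b‖ ≤ 2 * δ := by
  have hδ : 0 ≤ δ := (abs_nonneg _).trans (h 0)
  refine abs_le_of_sq_le_sq' ?_ (by linarith) |>.2
  rw [EuclideanSpace.norm_sq_eq, Fin.sum_univ_two]
  have h0 := pow_le_pow_left₀ (abs_nonneg _) (h 0) 2
  have h1 := pow_le_pow_left₀ (abs_nonneg _) (h 1) 2
  simp only [PiLp.sub_apply, Real.norm_eq_abs]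
  nlinarith

/-- Finite overlap of the families `𝐪(τ)`: if `𝒯` is a family of `E⁻¹`-caps with
overlap at most `C₀`, then each lattice cube `q` belongs to boundedly many of the
sets `𝐪(τ)`, `τ ∈ 𝒯`. -/
theorem lattice_cubes_finitely_overlapping
    (c₀ C₀ Cq : ℝ) (hc₀ : 0 < c₀) (hC₀ : c₀ < C₀) (hCq : 1 ≤ Cq) (C₁ : ℕ) :
    ∃ C' : ℕ, ∀ (R : ℕ), 1 ≤ R →
      ∀ (t : Fin R → ℝ), (∀ j, t j ∈ Set.Icc (1:ℝ) 4) →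
        (∀ j k, j ≠ k → ((R : ℝ))⁻¹ ≤ |t j - t k|) →
      ∀ (Φ : E2 → ℝ → ℝ), PhiHyp c₀ C₀ Φ →
      ∀ (E : ℝ), 1 < E → E ≤ (R : ℝ) ^ (1/2 : ℝ) →
      ∀ (ι : Type) (z : ι → E3), (∀ i, ‖z i‖ = 1) →
        (∀ v : E3, ‖v‖ = 1 →
          {i : ι | v ∈ capSet (z i) E⁻¹}.Finite ∧
          {i : ι | v ∈ capSet (z i) E⁻¹}.ncard ≤ C₁) →
      ∀ m : Fin 3 → ℤ,
        {i : ι | ∃ j : Fin R,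
          (qcube R Cq m 1 ∩ gammaTau Φ (t j) (z i) E⁻¹).Nonempty}.Finite ∧
        {i : ι | ∃ j : Fin R,
          (qcube R Cq m 1 ∩ gammaTau Φ (t j) (z i) E⁻¹).Nonempty}.ncard ≤ C' := by
  obtain ⟨N, hN⟩ := exists_ncard_le_of_bounded_overlap
    (4 + 2 * (2 * C₀ + C₀ / c₀ * (3 + 2 * C₀)) * Cq) C₁
  refine ⟨N, fun R hR t ht _ Φ hΦ E hE hER ι z hz hov m =>
    hN E (by linarith) ι z hz hov _ ?_⟩
  rintro i ⟨j, -, hx, v, ⟨hv, hGv⟩, rfl⟩ k ⟨l, -, hy, w, ⟨hw, hGw⟩, rfl⟩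
  rw [mem_closedBall_zero_iff] at hv hw
  have hC : 0 < C₀ := hc₀.trans hC₀
  have hcoord := abs_sub_le_of_mem_qcube hx hy
  have hvw : ‖v - w‖ ≤ 2 * (Cq * (R : ℝ) ^ (-(1/2) : ℝ)) := by
    refine norm_sub_le_two_mul_of_coord fun i => ?_
    fin_cases i
    · simpa [mk3] using hcoord 0
    · simpa [mk3] using hcoord 1
  have hval : |Φ v (t j) - Φ w (t l)| ≤ Cq * (R : ℝ) ^ (-(1/2) : ℝ) := by
    simpa [mk3] using hcoord 2
  have hG := hΦ.norm_gaussMapAt_sub_le hc₀ hC₀ hv hw (ht j) (ht l) hvw hval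
  have hRE : (R : ℝ) ^ (-(1/2) : ℝ) ≤ E⁻¹ := by
    rw [Real.rpow_neg (Nat.cast_nonneg R)]
    gcongr
  have hG' : ‖gaussMapAt Φ (t j) v - gaussMapAt Φ (t l) w‖
      ≤ 2 * (2 * C₀ + C₀ / c₀ * (3 + 2 * C₀)) * (Cq * E⁻¹) := hG.trans (by gcongr)
  have h1 := hGv.2
  have h2 := hGw.2
  rw [norm_sub_rev] at h1
  have h3 := norm_sub_le_norm_sub_add_norm_sub (z i) (gaussMapAt Φ (t j) v) (z k)
  have h4 := norm_sub_le_norm_sub_add_norm_sub (gaussMapAt Φ (t j) v)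
    (gaussMapAt Φ (t l) w) (z k)
  linarith
end
end

section
/- Let T be a finite index set and let A be an even positive integer. For c : T → ℝ_{≥0} define Br_A c := min over subsets S ⊆ T with |S| ≤ A of ( max_{τ ∈ T ∖ S} c(τ) ), where the maximum over the empty set is 0. If a, b, c : T → ℝ_{≥0} satisfy c(τ) ≤ a(τ) + b(τ) for every τ ∈ T, then Br_A c ≤ Br_{A/2} a + Br_{A/2} b. -/
open scoped NNReal

noncomputable section

/-- The `A`-broad part of `c : ι → ℝ≥0` over the finite index set `T`:
the `(A+1)`-th largest value, i.e. `min_{S ⊆ T, |S| ≤ A} max_{τ ∈ T \ S} c τ`,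
where the maximum over the empty set is `0`. -/
def broad {ι : Type*} [DecidableEq ι] (T : Finset ι) (A : ℕ) (c : ι → ℝ≥0) : ℝ≥0 :=
  sInf {x : ℝ≥0 | ∃ S : Finset ι, S ⊆ T ∧ S.card ≤ A ∧ x = (T \ S).sup c}

/-- The minimum defining the broad part is attained. -/
theorem exists_broad_eq {ι : Type*} [DecidableEq ι] (T : Finset ι) (A : ℕ) (c : ι → ℝ≥0) :
    ∃ S : Finset ι, S ⊆ T ∧ S.card ≤ A ∧ broad T A c = (T \ S).sup c := by
  have hne : {x : ℝ≥0 | ∃ S : Finset ι, S ⊆ T ∧ S.card ≤ A ∧ x = (T \ S).sup c}.Nonempty :=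
    ⟨_, ∅, Finset.empty_subset T, by simp, rfl⟩
  refine hne.csInf_mem ((T.powerset.image fun S => (T \ S).sup c).finite_toSet.subset ?_)
  rintro x ⟨S, hS, -, rfl⟩
  exact Finset.mem_coe.2 (Finset.mem_image_of_mem _ (Finset.mem_powerset.2 hS))

theorem broad_le_sup_sdiff {ι : Type*} [DecidableEq ι] {T S : Finset ι} {A : ℕ}
    (hS : S ⊆ T) (hA : S.card ≤ A) (c : ι → ℝ≥0) : broad T A c ≤ (T \ S).sup c :=
  csInf_le (OrderBot.bddBelow _) ⟨S, hS, hA, rfl⟩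

/-- Subadditivity of the broad part, with the exceptional sets of `a` and `b` of sizes
at most `A` and `B`. -/
theorem broad_add_le {ι : Type*} [DecidableEq ι] (T : Finset ι) (A B : ℕ)
    (a b c : ι → ℝ≥0) (h : ∀ τ ∈ T, c τ ≤ a τ + b τ) :
    broad T (A + B) c ≤ broad T A a + broad T B b := by
  obtain ⟨S, hST, hSA, hS⟩ := exists_broad_eq T A a
  obtain ⟨U, hUT, hUB, hU⟩ := exists_broad_eq T B b
  rw [hS, hU]
  refine (broad_le_sup_sdiff (Finset.union_subset hST hUT)
    ((Finset.card_union_le S U).trans (add_le_add hSA hUB)) c).trans (Finset.sup_le ?_)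
  intro τ hτ
  simp only [Finset.mem_sdiff, Finset.mem_union, not_or] at hτ
  obtain ⟨hT, hτS, hτU⟩ := hτ
  exact (h τ hT).trans (add_le_add (Finset.le_sup (Finset.mem_sdiff.2 ⟨hT, hτS⟩))
    (Finset.le_sup (Finset.mem_sdiff.2 ⟨hT, hτU⟩)))

/-- Triangle inequality for the broad part: if `A` is even and positive and
`c ≤ a + b` pointwise on `T`, then `Br_A c ≤ Br_{A/2} a + Br_{A/2} b`. -/
theorem broad_triangle {ι : Type*} [DecidableEq ι] (T : Finset ι) (A : ℕ)
    (hA : Even A) (hA0 : 0 < A) (a b c : ι → ℝ≥0)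
    (h : ∀ τ ∈ T, c τ ≤ a τ + b τ) :
    broad T A c ≤ broad T (A / 2) a + broad T (A / 2) b := by
  obtain ⟨n, rfl⟩ := hA
  have hn : (n + n) / 2 = n := by omega
  rw [hn]
  exact broad_add_le T n n a b c h
end
end

section
/- Let φ : ℝ³ → ℂ satisfy |φ(x)| ≤ C_N (1 + |x|)^{−N} for every N ∈ ℕ, and for m ∈ ℤ³ set φ_m(x) := e^{−2πi m·x} φ(x). Then for every N ∈ ℕ there is a constant C (depending only on N and the decay constants of φ) such that for every f ∈ L²_loc(ℝ³) and every x ∈ ℝ³, Σ_{m ∈ ℤ³} | (φ_m ∗ f)(x) |² ≤ C ∫_{ℝ³} (1 + |y|)^{−N} |f(x − y)|² dy. -/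
open MeasureTheory Metric Set
open scoped ENNReal NNReal Real

noncomputable section

/-- The modulation `φ_m(x) = e^{-2πi m·x} φ(x)` for `m ∈ ℤ³`. -/
def modulate (φ : E3 → ℂ) (m : Fin 3 → ℤ) (x : E3) : ℂ :=
  Complex.exp (-(2 * Real.pi * Complex.I * (∑ i, (m i : ℂ) * (x i : ℂ)))) * φ x

/-- The character `e^{-2πi m·y}` of `ℝ³`. -/
def phase (m : Fin 3 → ℤ) (y : E3) : ℂ :=
  Complex.exp (-(2 * Real.pi * Complex.I * (∑ i, (m i : ℂ) * (y i : ℂ))))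

lemma modulate_eq_phase_mul (φ : E3 → ℂ) (m : Fin 3 → ℤ) (y : E3) :
    modulate φ m y = phase m y * φ y := rfl

lemma continuous_phase (m : Fin 3 → ℤ) : Continuous (phase m) := by
  unfold phase
  fun_prop

lemma norm_phase (m : Fin 3 → ℤ) (y : E3) : ‖phase m y‖ = 1 := by
  have : phase m y
      = Complex.exp ((-(2 * Real.pi * ∑ i, (m i : ℝ) * y i) : ℝ) * Complex.I) := by
    unfold phase
    congr 1
    push_cast
    ring
  rw [this, Complex.norm_exp_ofReal_mul_I]

lemma phase_add (m n : Fin 3 → ℤ) (y : E3) : phase (m + n) y = phase m y * phase n y := by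
  unfold phase
  rw [← Complex.exp_add]
  congr 1
  simp only [Pi.add_apply, Int.cast_add, add_mul, Finset.sum_add_distrib]
  ring

lemma phase_neg_mul_phase (m : Fin 3 → ℤ) (y : E3) : phase (-m) y * phase m y = 1 := by
  rw [← phase_add]
  simp [phase]

lemma conj_phase (m : Fin 3 → ℤ) (y : E3) : starRingEnd ℂ (phase m y) = phase (-m) y := by
  unfold phase
  rw [← Complex.exp_conj]
  congr 1
  simp [Complex.conj_ofNat]

lemma phase_eq_prod (m : Fin 3 → ℤ) (y : E3) :
    phase m y = ∏ i, Complex.exp (-(2 * Real.pi * Complex.I * m i) * (y i : ℂ)) := by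
  unfold phase
  rw [← Complex.exp_sum]
  congr 1
  simp only [Finset.mul_sum, ← Finset.sum_neg_distrib]
  exact Finset.sum_congr rfl fun i _ => by ring

lemma integral_Ico_exp (n : ℤ) (a : ℝ) :
    ∫ t in Ico a (a + 1), Complex.exp (-(2 * Real.pi * Complex.I * n) * (t : ℂ))
      = if n = 0 then 1 else 0 := by
  rw [integral_Ico_eq_integral_Ioc, ← intervalIntegral.integral_of_le (by linarith)]
  split_ifs with h
  · simp [h]
  · have hc : -(2 * Real.pi * Complex.I * n) ≠ 0 := by
      simp [Complex.I_ne_zero, Real.pi_ne_zero, h]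
    rw [integral_exp_mul_complex hc]
    have : -(2 * Real.pi * Complex.I * n) * ((a + 1 : ℝ) : ℂ)
        = -(2 * Real.pi * Complex.I * n) * (a : ℂ)
          + ((-n : ℤ) : ℂ) * (2 * Real.pi * Complex.I) := by
      push_cast
      ring
    rw [this, Complex.exp_add, Complex.exp_int_mul_two_pi_mul_I]
    simp

/-- The half-open unit cube in `ℝ³` with lower corner `k ∈ ℤ³`. -/
def unitCube (k : Fin 3 → ℤ) : Set E3 :=
  WithLp.ofLp ⁻¹' univ.pi fun i => Ico (k i : ℝ) (k i + 1)

lemma measurableSet_unitCube (k : Fin 3 → ℤ) : MeasurableSet (unitCube k) :=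
  (PiLp.volume_preserving_ofLp (Fin 3)).measurable
    (MeasurableSet.univ_pi fun _ => measurableSet_Ico)

lemma mem_unitCube {k : Fin 3 → ℤ} {y : E3} : y ∈ unitCube k ↔ ∀ i, ⌊y i⌋ = k i := by
  simp [unitCube, Int.floor_eq_iff]

lemma pairwise_disjoint_unitCube : Pairwise (Function.onFun Disjoint unitCube) := by
  intro k l hkl
  refine Set.disjoint_left.2 fun y hk hl => hkl (funext fun i => ?_)
  rw [← mem_unitCube.1 hk i, mem_unitCube.1 hl i]

lemma iUnion_unitCube : ⋃ k, unitCube k = univ :=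
  eq_univ_of_forall fun y => mem_iUnion.2 ⟨fun i => ⌊y i⌋, mem_unitCube.2 fun _ => rfl⟩

lemma volume_unitCube (k : Fin 3 → ℤ) : volume (unitCube k) = 1 := by
  rw [unitCube, (PiLp.volume_preserving_ofLp (Fin 3)).measure_preimage
    (MeasurableSet.univ_pi fun _ => measurableSet_Ico).nullMeasurableSet, volume_pi_pi]
  simp

instance (k : Fin 3 → ℤ) : IsProbabilityMeasure (volume.restrict (unitCube k)) :=
  ⟨by simp [volume_unitCube]⟩

lemma one_add_norm_le_of_mem_unitCube {k : Fin 3 → ℤ} {y z : E3} (hy : y ∈ unitCube k)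
    (hz : z ∈ unitCube k) : 1 + ‖y‖ ≤ 3 * (1 + ‖z‖) := by
  have h : ‖y - z‖ ≤ 2 := by
    rw [EuclideanSpace.norm_eq, Real.sqrt_le_left (by norm_num)]
    have hi : ∀ i, ‖(y - z) i‖ ^ 2 ≤ 1 := fun i => by
      have := Int.abs_sub_lt_one_of_floor_eq_floor
        ((mem_unitCube.1 hy i).trans (mem_unitCube.1 hz i).symm)
      simpa using this.le
    calc ∑ i, ‖(y - z) i‖ ^ 2 ≤ ∑ _i : Fin 3, (1 : ℝ) := Finset.sum_le_sum fun i _ => hi i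
      _ ≤ 2 ^ 2 := by norm_num
  have := norm_le_norm_add_norm_sub' y z
  have := norm_nonneg z
  linarith

lemma integral_unitCube_phase (k m : Fin 3 → ℤ) :
    ∫ y in unitCube k, phase m y = if m = 0 then 1 else 0 := by
  have hemb : MeasurableEmbedding (WithLp.ofLp : E3 → Fin 3 → ℝ) :=
    (MeasurableEquiv.toLp 2 (Fin 3 → ℝ)).symm.measurableEmbedding
  simp_rw [phase_eq_prod]
  rw [unitCube, (PiLp.volume_preserving_ofLp (Fin 3)).setIntegral_preimage_emb hemb
    (fun y => ∏ i, Complex.exp (-(2 * Real.pi * Complex.I * m i) * (y i : ℂ))),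
    volume_pi, Measure.restrict_pi_pi, integral_fintype_prod_eq_prod
    (fun i (t : ℝ) => Complex.exp (-(2 * Real.pi * Complex.I * m i) * (t : ℂ)))]
  simp_rw [integral_Ico_exp, Finset.prod_ite_zero]
  simp [funext_iff]

lemma memLp_phase (k m : Fin 3 → ℤ) : MemLp (phase m) 2 (volume.restrict (unitCube k)) :=
  MemLp.of_bound (continuous_phase m).aestronglyMeasurable 1
    (Filter.Eventually.of_forall fun y => (norm_phase m y).le)

lemma inner_toLp_phase (k m : Fin 3 → ℤ) {g : E3 → ℂ}
    (hg : MemLp g 2 (volume.restrict (unitCube k))) :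
    inner ℂ ((memLp_phase k (-m)).toLp (phase (-m))) (hg.toLp g)
      = ∫ y in unitCube k, phase m y * g y := by
  rw [L2.inner_def]
  refine integral_congr_ae ?_
  filter_upwards [(memLp_phase k (-m)).coeFn_toLp, hg.coeFn_toLp] with y h1 h2
  rw [h1, h2, RCLike.inner_apply, conj_phase, neg_neg, mul_comm]

lemma orthonormal_phase (k : Fin 3 → ℤ) :
    Orthonormal ℂ fun m => (memLp_phase k (-m)).toLp (phase (-m)) := by
  rw [orthonormal_iff_ite]
  intro m n
  simp_rw [inner_toLp_phase, ← phase_add, integral_unitCube_phase, add_neg_eq_zero]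

/-- Bessel's inequality on a unit cube. -/
lemma tsum_enorm_integral_unitCube_sq_le (k : Fin 3 → ℤ) {g : E3 → ℂ}
    (hg : AEStronglyMeasurable g (volume.restrict (unitCube k))) :
    ∑' m, ‖∫ y in unitCube k, phase m y * g y‖ₑ ^ 2 ≤ ∫⁻ y in unitCube k, ‖g y‖ₑ ^ 2 := by
  have hnorm : eLpNorm g 2 (volume.restrict (unitCube k)) ^ 2
      = ∫⁻ y in unitCube k, ‖g y‖ₑ ^ 2 := by
    simpa using eLpNorm_nnreal_pow_eq_lintegral (f := g) (p := 2)
      (μ := volume.restrict (unitCube k)) two_ne_zero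
  rw [← hnorm]
  by_cases hfin : eLpNorm g 2 (volume.restrict (unitCube k)) = ⊤
  · simp [hfin]
  have hL : MemLp g 2 (volume.restrict (unitCube k)) := ⟨hg, lt_top_iff_ne_top.2 hfin⟩
  have hsum := (orthonormal_phase k).inner_products_summable (hL.toLp g)
  have hle := (orthonormal_phase k).tsum_inner_products_le (hL.toLp g)
  simp_rw [inner_toLp_phase] at hsum hle
  rw [Lp.norm_toLp] at hle
  have := ENNReal.ofReal_le_ofReal hle
  rw [ENNReal.ofReal_tsum_of_nonneg (fun _ => by positivity) hsum,
    ENNReal.ofReal_pow (by positivity), ENNReal.ofReal_toReal hfin] at this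
  simpa only [ENNReal.ofReal_pow (norm_nonneg _), ofReal_norm] using this

/-- Weighted Cauchy-Schwarz inequality for series. -/
lemma ENNReal.tsum_sq_le_tsum_mul_tsum_div {ι : Type*} (a p : ι → ℝ≥0∞) (hp0 : ∀ i, p i ≠ 0)
    (hp : ∀ i, p i ≠ ⊤) : (∑' i, a i) ^ 2 ≤ (∑' i, p i) * ∑' i, a i ^ 2 / p i := by
  let _ : MeasurableSpace ι := ⊤
  have h := ENNReal.lintegral_mul_le_Lp_mul_Lq (Measure.count : Measure ι)
    Real.HolderConjugate.two_two (f := fun i => p i ^ (1 / 2 : ℝ))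
    (g := fun i => a i / p i ^ (1 / 2 : ℝ)) measurable_from_top.aemeasurable
    measurable_from_top.aemeasurable
  have hq (i : ι) : (p i ^ (1 / 2 : ℝ)) ^ (2 : ℝ) = p i := by
    rw [← ENNReal.rpow_mul]
    norm_num
  have hm (i : ι) : p i ^ (1 / 2 : ℝ) * (a i / p i ^ (1 / 2 : ℝ)) = a i :=
    ENNReal.mul_div_cancel (by simp [hp0, hp]) (by simp [hp0, hp])
  simp only [lintegral_count, Pi.mul_apply, hm, hq,
    ENNReal.div_rpow_of_nonneg _ _ zero_le_two] at h
  calc (∑' i, a i) ^ 2 ≤ _ := pow_le_pow_left' h 2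
    _ = _ := by
      rw [mul_pow, ← ENNReal.rpow_natCast, ← ENNReal.rpow_natCast, ← ENNReal.rpow_mul,
        ← ENNReal.rpow_mul]
      norm_num

/-- The mass of a unit cube for the weight `(1 + ‖y‖) ^ (-4)`. -/
def cubeWeight (k : Fin 3 → ℤ) : ℝ≥0∞ :=
  ∫⁻ y in unitCube k, ENNReal.ofReal ((1 + ‖y‖) ^ (-4 : ℝ))

lemma tsum_cubeWeight :
    ∑' k, cubeWeight k = ∫⁻ y : E3, ENNReal.ofReal ((1 + ‖y‖) ^ (-4 : ℝ)) := by
  unfold cubeWeight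
  rw [← lintegral_iUnion measurableSet_unitCube pairwise_disjoint_unitCube, iUnion_unitCube,
    Measure.restrict_univ]

lemma tsum_cubeWeight_lt_top : ∑' k, cubeWeight k < ⊤ := by
  rw [tsum_cubeWeight]
  exact finite_integral_one_add_norm (by rw [finrank_euclideanSpace_fin]; norm_num)

lemma cubeWeight_ne_top (k : Fin 3 → ℤ) : cubeWeight k ≠ ⊤ :=
  ((ENNReal.le_tsum k).trans_lt tsum_cubeWeight_lt_top).ne

lemma ofReal_le_cubeWeight {k : Fin 3 → ℤ} {y : E3} (hy : y ∈ unitCube k) :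
    ENNReal.ofReal ((3 * (1 + ‖y‖)) ^ (-4 : ℝ)) ≤ cubeWeight k := by
  calc ENNReal.ofReal ((3 * (1 + ‖y‖)) ^ (-4 : ℝ))
      = ∫⁻ _z in unitCube k, ENNReal.ofReal ((3 * (1 + ‖y‖)) ^ (-4 : ℝ)) := by simp
    _ ≤ cubeWeight k := setLIntegral_mono' (measurableSet_unitCube k) fun z hz =>
        ENNReal.ofReal_le_ofReal <| Real.rpow_le_rpow_of_nonpos (by positivity)
          (one_add_norm_le_of_mem_unitCube hz hy) (by norm_num)

lemma unitCube_nonempty (k : Fin 3 → ℤ) : (unitCube k).Nonempty :=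
  nonempty_of_measure_ne_zero (μ := volume) (by simp [volume_unitCube])

lemma cubeWeight_ne_zero (k : Fin 3 → ℤ) : cubeWeight k ≠ 0 := by
  obtain ⟨y, hy⟩ := unitCube_nonempty k
  exact ((ENNReal.ofReal_pos.2 (by positivity)).trans_le (ofReal_le_cubeWeight hy)).ne'

lemma inv_cubeWeight_le {k : Fin 3 → ℤ} {y : E3} (hy : y ∈ unitCube k) :
    (cubeWeight k)⁻¹ ≤ ENNReal.ofReal ((3 * (1 + ‖y‖)) ^ 4) := by
  rw [ENNReal.inv_le_iff_inv_le, ← ENNReal.ofReal_inv_of_pos (by positivity)]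
  convert ofReal_le_cubeWeight hy using 2
  rw [Real.rpow_neg (by positivity)]
  norm_cast

lemma tsum_enorm_integral_phase_sq_le {g : E3 → ℂ} (hg : Integrable g) :
    ∑' m, ‖∫ y, phase m y * g y‖ₑ ^ 2
      ≤ (∑' k, cubeWeight k) * ∫⁻ y, ENNReal.ofReal ((3 * (1 + ‖y‖)) ^ 4) * ‖g y‖ₑ ^ 2 := by
  have hsplit (m : Fin 3 → ℤ) : ‖∫ y, phase m y * g y‖ₑ ^ 2
      ≤ (∑' k, cubeWeight k)
        * ∑' k, ‖∫ y in unitCube k, phase m y * g y‖ₑ ^ 2 / cubeWeight k := by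
    have hint : Integrable fun y => phase m y * g y :=
      hg.bdd_mul (continuous_phase m).aestronglyMeasurable
        (Filter.Eventually.of_forall fun y => (norm_phase m y).le)
    have hS := hasSum_integral_iUnion measurableSet_unitCube pairwise_disjoint_unitCube
      (hint.integrableOn (s := ⋃ k, unitCube k))
    rw [iUnion_unitCube, Measure.restrict_univ] at hS
    rw [← hS.tsum_eq]
    exact (pow_le_pow_left' enorm_tsum_le_tsum_enorm 2).trans
      (ENNReal.tsum_sq_le_tsum_mul_tsum_div _ _ cubeWeight_ne_zero cubeWeight_ne_top)
  calc _ ≤ _ := ENNReal.tsum_le_tsum hsplit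
    _ = (∑' k, cubeWeight k) * ∑' k, (cubeWeight k)⁻¹
          * ∑' m, ‖∫ y in unitCube k, phase m y * g y‖ₑ ^ 2 := by
      rw [ENNReal.tsum_mul_left, ENNReal.tsum_comm]
      simp_rw [div_eq_mul_inv, ENNReal.tsum_mul_right, mul_comm]
    _ ≤ (∑' k, cubeWeight k) * ∑' k, ∫⁻ y in unitCube k,
          ENNReal.ofReal ((3 * (1 + ‖y‖)) ^ 4) * ‖g y‖ₑ ^ 2 := by
      gcongr with k
      refine (mul_le_mul_right (tsum_enorm_integral_unitCube_sq_le k hg.1.restrict) _).trans ?_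
      rw [← lintegral_const_mul' _ _ (ENNReal.inv_ne_top.2 (cubeWeight_ne_zero k))]
      exact setLIntegral_mono' (measurableSet_unitCube k) fun y hy => by
        gcongr
        exact inv_cubeWeight_le hy
    _ = _ := by
      rw [← lintegral_iUnion measurableSet_unitCube pairwise_disjoint_unitCube, iUnion_unitCube,
        Measure.restrict_univ]

lemma integrable_phase_mul_iff (m : Fin 3 → ℤ) (g : E3 → ℂ) :
    Integrable (fun y => phase m y * g y) ↔ Integrable g := by
  have key (n : Fin 3 → ℤ) {h : E3 → ℂ} (hh : Integrable h) :
      Integrable fun y => phase n y * h y :=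
    hh.bdd_mul (continuous_phase n).aestronglyMeasurable
      (Filter.Eventually.of_forall fun y => (norm_phase n y).le)
  refine ⟨fun h => ?_, key m⟩
  simpa [← mul_assoc, phase_neg_mul_phase] using key (-m) h

lemma weight_mul_sq_le {r t d : ℝ} {N : ℕ} (ht : 0 ≤ t) (hr : 0 ≤ r)
    (h : r ≤ d * (1 + t) ^ (-((N + 2 : ℕ) : ℝ))) :
    (3 * (1 + t)) ^ 4 * r ^ 2 ≤ 81 * d ^ 2 * (1 + t) ^ (-(N : ℝ)) := by
  have h1 : 1 ≤ 1 + t := by linarith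
  have hpos : 0 < 1 + t := by linarith
  rw [Real.rpow_neg hpos.le, Real.rpow_natCast] at h ⊢
  calc (3 * (1 + t)) ^ 4 * r ^ 2
      ≤ (3 * (1 + t)) ^ 4 * (d * ((1 + t) ^ (N + 2))⁻¹) ^ 2 := by gcongr
    _ = 81 * d ^ 2 * (((1 + t) ^ N)⁻¹ * ((1 + t) ^ N)⁻¹) := by
      field_simp
      ring
    _ ≤ 81 * d ^ 2 * (((1 + t) ^ N)⁻¹ * 1) := by
      gcongr
      exact inv_le_one_of_one_le₀ (one_le_pow₀ h1)
    _ = _ := by rw [mul_one]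

/-- Consequence of the Poisson summation formula: if `φ` decays rapidly, then for every
`N` there is a constant `C`, depending only on `N` and the decay constants of `φ`,
such that for every locally square-integrable `f` and every `x`,
`Σ_{m ∈ ℤ³} |(φ_m ∗ f)(x)|² ≤ C ∫ (1+|y|)^{-N} |f(x-y)|² dy`. -/
theorem poisson_summation_modulation_bound (D : ℕ → ℝ) (N : ℕ) :
    ∃ C : ℝ, 0 < C ∧
      ∀ (φ : E3 → ℂ),
        (∀ (K : ℕ) (x : E3), ‖φ x‖ ≤ D K * (1 + ‖x‖) ^ (-(K : ℝ))) →
      ∀ (f : E3 → ℂ),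
        AEStronglyMeasurable f volume →
        LocallyIntegrable (fun x => ‖f x‖ ^ 2) volume →
      ∀ x : E3,
        ∑' m : Fin 3 → ℤ,
            ((‖∫ y : E3, modulate φ m y * f (x - y)‖₊ : ℝ≥0∞) ^ 2) ≤
          ENNReal.ofReal C *
            ∫⁻ y : E3, ENNReal.ofReal ((1 + ‖y‖) ^ (-(N : ℝ))) * (‖f (x - y)‖₊ : ℝ≥0∞) ^ 2 := by
  set S := ∑' k, cubeWeight k
  have hS_top : S ≠ ⊤ := tsum_cubeWeight_lt_top.ne
  refine ⟨S.toReal * (81 * D (N + 2) ^ 2) + 1, by positivity, fun φ hφ f _ _ x => ?_⟩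
  by_cases hg : Integrable fun y => φ y * f (x - y)
  · have hpt (y : E3) : ENNReal.ofReal ((3 * (1 + ‖y‖)) ^ 4) * ‖φ y * f (x - y)‖ₑ ^ 2
        ≤ ENNReal.ofReal (81 * D (N + 2) ^ 2)
          * (ENNReal.ofReal ((1 + ‖y‖) ^ (-(N : ℝ))) * ‖f (x - y)‖ₑ ^ 2) := by
      rw [enorm_mul, mul_pow ‖φ y‖ₑ, ← mul_assoc, ← mul_assoc, ← ofReal_norm (φ y),
        ← ENNReal.ofReal_pow (norm_nonneg _), ← ENNReal.ofReal_mul (by positivity),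
        ← ENNReal.ofReal_mul (by positivity)]
      refine mul_le_mul_left (ENNReal.ofReal_le_ofReal ?_) _
      exact weight_mul_sq_le (norm_nonneg y) (norm_nonneg _) (hφ (N + 2) y)
    calc _ = ∑' m, ‖∫ y, phase m y * (φ y * f (x - y))‖ₑ ^ 2 := by
          simp_rw [modulate_eq_phase_mul, mul_assoc, enorm_eq_nnnorm]
      _ ≤ S * ∫⁻ y, ENNReal.ofReal ((3 * (1 + ‖y‖)) ^ 4) * ‖φ y * f (x - y)‖ₑ ^ 2 :=
          tsum_enorm_integral_phase_sq_le hg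
      _ ≤ S * ∫⁻ y, ENNReal.ofReal (81 * D (N + 2) ^ 2)
            * (ENNReal.ofReal ((1 + ‖y‖) ^ (-(N : ℝ))) * ‖f (x - y)‖ₑ ^ 2) := by
          exact mul_le_mul_right (lintegral_mono hpt) _
      _ = ENNReal.ofReal (S.toReal * (81 * D (N + 2) ^ 2))
            * ∫⁻ y, ENNReal.ofReal ((1 + ‖y‖) ^ (-(N : ℝ))) * ‖f (x - y)‖ₑ ^ 2 := by
          rw [lintegral_const_mul' _ _ ENNReal.ofReal_ne_top, ← mul_assoc,
            ENNReal.ofReal_mul ENNReal.toReal_nonneg, ENNReal.ofReal_toReal hS_top]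
      _ ≤ _ := by
          gcongr
          · linarith
          · exact le_rfl
  · have hzero (m : Fin 3 → ℤ) : ∫ y, modulate φ m y * f (x - y) = 0 := by
      simp_rw [modulate_eq_phase_mul, mul_assoc]
      exact integral_undef (mt (integrable_phase_mul_iff m _).1 hg)
    simp [hzero]
end
end
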